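/- A convex quadrangle Q ⊆ ℝ² is 2-self-affine if and only if Q is a trapezoid; that is, there exist invertible affine maps φ₁, φ₂ : ℝ² → ℝ² with Q = φ₁(Q) ∪ φ₂(Q) and the interiors of φ₁(Q) and φ₂(Q) disjoint, if and only if Q has at least one pair of parallel opposite sides. -/

import Mathlib

open Set

/-- A compact set `P ⊆ ℝ²` is `n`-self-affine if there are invertible affine maps
`φ₁, …, φₙ` such that `P = φ₁(P) ∪ ⋯ ∪ φₙ(P)` and the interiors of the `φᵢ(P)`
are pairwise disjoint. -/
def IsSelfAffine (n : ℕ) (P : Set (ℝ × ℝ)) : Prop :=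
  ∃ φ : Fin n → ((ℝ × ℝ) ≃ᵃ[ℝ] (ℝ × ℝ)),
    (⋃ i, φ i '' P) = P ∧
    Pairwise fun i j => Disjoint (interior (φ i '' P)) (interior (φ j '' P))

/-- A convex quadrangle is the convex hull of four points of `ℝ²`, none of which lies
in the convex hull of the other three. -/
def IsConvexQuadrangle (Q : Set (ℝ × ℝ)) : Prop :=
  ∃ a b c d : ℝ × ℝ,
    Q = convexHull ℝ {a, b, c, d} ∧
    a ∉ convexHull ℝ ({b, c, d} : Set (ℝ × ℝ)) ∧
    b ∉ convexHull ℝ ({a, c, d} : Set (ℝ × ℝ)) ∧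
    c ∉ convexHull ℝ ({a, b, d} : Set (ℝ × ℝ)) ∧
    d ∉ convexHull ℝ ({a, b, c} : Set (ℝ × ℝ))

/-- A trapezoid is a convex quadrangle having at least one pair of parallel opposite
sides.  The vertices `a, b, c, d` are in cyclic order (expressed by the crossing of the
diagonals `ac` and `bd`), so the sides are `ab`, `bc`, `cd`, `da`, and a pair of
opposite sides is parallel iff `c - d` is a multiple of `b - a` or `a - d` is a multiple
of `c - b`.  Parallelograms count as trapezoids. -/
def IsTrapezoid (Q : Set (ℝ × ℝ)) : Prop :=
  ∃ a b c d : ℝ × ℝ,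
    Q = convexHull ℝ {a, b, c, d} ∧
    a ∉ convexHull ℝ ({b, c, d} : Set (ℝ × ℝ)) ∧
    b ∉ convexHull ℝ ({a, c, d} : Set (ℝ × ℝ)) ∧
    c ∉ convexHull ℝ ({a, b, d} : Set (ℝ × ℝ)) ∧
    d ∉ convexHull ℝ ({a, b, c} : Set (ℝ × ℝ)) ∧
    (segment ℝ a c ∩ segment ℝ b d).Nonempty ∧
    ((∃ t : ℝ, c - d = t • (b - a)) ∨ (∃ t : ℝ, a - d = t • (c - b)))

/-- Linear independence of two vectors, spelled out. -/
def Indep2 (v w : ℝ × ℝ) : Prop := ∀ y z : ℝ, y • v + z • w = 0 → y = 0 ∧ z = 0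

/-- `A B C D` are the vertices, in cyclic order, of a nondegenerate convex quadrangle, and
`a, b, c, d` are the (positive) weights of the affine dependency `aA + cC = bB + dD`. -/
structure Quad (A B C D : ℝ × ℝ) (a b c d : ℝ) : Prop where
  ha : 0 < a
  hb : 0 < b
  hc : 0 < c
  hd : 0 < d
  hs : a + c = b + d
  hv : a • A + c • C = b • B + d • D
  ind : Indep2 (B - A) (D - A)

/-- None of the four points lies in the convex hull of the other three. -/
def NH (a b c d : ℝ × ℝ) : Prop :=
    a ∉ convexHull ℝ ({b, c, d} : Set (ℝ × ℝ)) ∧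
    b ∉ convexHull ℝ ({a, c, d} : Set (ℝ × ℝ)) ∧
    c ∉ convexHull ℝ ({a, b, d} : Set (ℝ × ℝ)) ∧
    d ∉ convexHull ℝ ({a, b, c} : Set (ℝ × ℝ))

lemma mem_hull4 (A B C D X : ℝ × ℝ) : X ∈ convexHull ℝ ({A, B, C, D} : Set (ℝ × ℝ)) ↔
    ∃ p q r s : ℝ, 0 ≤ p ∧ 0 ≤ q ∧ 0 ≤ r ∧ 0 ≤ s ∧ p + q + r + s = 1 ∧
      X = p • A + q • B + r • C + s • D := by
  constructor
  · intro h
    have key : convexHull ℝ ({A, B, C, D} : Set (ℝ × ℝ)) ⊆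
        {X | ∃ p q r s : ℝ, 0 ≤ p ∧ 0 ≤ q ∧ 0 ≤ r ∧ 0 ≤ s ∧ p + q + r + s = 1 ∧
      X = p • A + q • B + r • C + s • D} := by
      apply convexHull_min
      · intro Y hY
        simp only [mem_insert_iff, mem_singleton_iff] at hY
        rcases hY with rfl | rfl | rfl | rfl
        · exact ⟨1, 0, 0, 0, by norm_num, by norm_num, by norm_num, by norm_num, by norm_num, by simp⟩
        · exact ⟨0, 1, 0, 0, by norm_num, by norm_num, by norm_num, by norm_num, by norm_num, by simp⟩
        · exact ⟨0, 0, 1, 0, by norm_num, by norm_num, by norm_num, by norm_num, by norm_num, by simp⟩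
        · exact ⟨0, 0, 0, 1, by norm_num, by norm_num, by norm_num, by norm_num, by norm_num, by simp⟩
      · rintro X ⟨p, q, r, s, hp, hq, hr, hs, h1, rfl⟩ Y ⟨p', q', r', s', hp', hq', hr', hs', h1', rfl⟩
          m n hm hn hmn
        refine ⟨m * p + n * p', m * q + n * q', m * r + n * r', m * s + n * s', by positivity,
          by positivity, by positivity, by positivity, ?_, by module⟩
        linear_combination m * h1 + n * h1' + hmn
    exact key h
  · rintro ⟨p, q, r, s, hp, hq, hr, hs, h1, rfl⟩
    refine mem_convexHull_of_exists_fintype (ι := Fin 4) ![p, q, r, s] ![A, B, C, D] ?_ ?_ ?_ ?_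
    · intro i; fin_cases i <;> simpa
    · simpa [Fin.sum_univ_four] using h1
    · intro i; fin_cases i <;> simp
    · simp [Fin.sum_univ_four]

lemma mem_hull3 (B C D X : ℝ × ℝ) : X ∈ convexHull ℝ ({B, C, D} : Set (ℝ × ℝ)) ↔
    ∃ q r s : ℝ, 0 ≤ q ∧ 0 ≤ r ∧ 0 ≤ s ∧ q + r + s = 1 ∧
      X = q • B + r • C + s • D := by
  have : ({B, C, D} : Set (ℝ × ℝ)) = {B, B, C, D} := by simp
  rw [this, mem_hull4]
  constructor
  · rintro ⟨p, q, r, s, hp, hq, hr, hs, h1, rfl⟩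
    exact ⟨p + q, r, s, by positivity, hr, hs, h1, by module⟩
  · rintro ⟨q, r, s, hq, hr, hs, h1, rfl⟩
    exact ⟨0, q, r, s, le_rfl, hq, hr, hs, by linarith, by module⟩

lemma not_alone {A B C D : ℝ × ℝ} (h : A ∉ convexHull ℝ ({B, C, D} : Set (ℝ × ℝ)))
    {x y z w : ℝ} (h0 : x + y + z + w = 0) (hv : x • A + y • B + z • C + w • D = 0)
    (hx : 0 < x) (hy : y ≤ 0) (hz : z ≤ 0) (hw : w ≤ 0) : False := by
  apply h
  rw [mem_hull3]
  refine ⟨-y / x, -z / x, -w / x, div_nonneg (by linarith) hx.le, div_nonneg (by linarith) hx.le,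
    div_nonneg (by linarith) hx.le, by field_simp; linarith, ?_⟩
  have : x • A = x • ((-y / x) • B + (-z / x) • C + (-w / x) • D) := by
    simp only [smul_add, smul_smul]
    rw [mul_div_cancel₀ _ hx.ne', mul_div_cancel₀ _ hx.ne', mul_div_cancel₀ _ hx.ne']
    linear_combination (norm := module) hv
  exact smul_right_injective _ hx.ne' this

lemma not_alone' {A B C D : ℝ × ℝ} (h : A ∉ convexHull ℝ ({B, C, D} : Set (ℝ × ℝ)))
    {x y z w : ℝ} (h0 : x + y + z + w = 0) (hv : x • A + y • B + z • C + w • D = 0)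
    (hx : x < 0) (hy : 0 ≤ y) (hz : 0 ≤ z) (hw : 0 ≤ w) : False := by
  refine not_alone h (x := -x) (y := -y) (z := -z) (w := -w) (by linarith) ?_ (by linarith)
    (by linarith) (by linarith) (by linarith)
  linear_combination (norm := module) (-1 : ℝ) • hv

lemma NH.signs {A B C D : ℝ × ℝ} (h : NH A B C D)
    {x y z w : ℝ} (h0 : x + y + z + w = 0) (hv : x • A + y • B + z • C + w • D = 0) :
    (x = 0 ∧ y = 0 ∧ z = 0 ∧ w = 0) ∨
    (0 < x ∧ 0 < y ∧ z < 0 ∧ w < 0) ∨ (0 < x ∧ y < 0 ∧ 0 < z ∧ w < 0) ∨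
    (0 < x ∧ y < 0 ∧ z < 0 ∧ 0 < w) ∨ (x < 0 ∧ 0 < y ∧ 0 < z ∧ w < 0) ∨
    (x < 0 ∧ 0 < y ∧ z < 0 ∧ 0 < w) ∨ (x < 0 ∧ y < 0 ∧ 0 < z ∧ 0 < w) := by
  obtain ⟨hA, hB, hC, hD⟩ := h
  have vB : y • B + x • A + z • C + w • D = 0 := by rw [← hv]; module
  have vC : z • C + x • A + y • B + w • D = 0 := by rw [← hv]; module
  have vD : w • D + x • A + y • B + z • C = 0 := by rw [← hv]; module
  have a1 := not_alone hA h0 hv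
  have a2 := not_alone' hA h0 hv
  have b1 := not_alone hB (by linarith) vB
  have b2 := not_alone' hB (by linarith) vB
  have c1 := not_alone hC (by linarith) vC
  have c2 := not_alone' hC (by linarith) vC
  have d1 := not_alone hD (by linarith) vD
  have d2 := not_alone' hD (by linarith) vD
  rcases lt_trichotomy x 0 with hx | hx | hx <;> rcases lt_trichotomy y 0 with hy | hy | hy <;>
  rcases lt_trichotomy z 0 with hz | hz | hz <;> rcases lt_trichotomy w 0 with hw | hw | hw <;>
  first
  | (exfalso; linarith)
  | (exfalso; exact a1 (by linarith) (by linarith) (by linarith) (by linarith))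
  | (exfalso; exact a2 (by linarith) (by linarith) (by linarith) (by linarith))
  | (exfalso; exact b1 (by linarith) (by linarith) (by linarith) (by linarith))
  | (exfalso; exact b2 (by linarith) (by linarith) (by linarith) (by linarith))
  | (exfalso; exact c1 (by linarith) (by linarith) (by linarith) (by linarith))
  | (exfalso; exact c2 (by linarith) (by linarith) (by linarith) (by linarith))
  | (exfalso; exact d1 (by linarith) (by linarith) (by linarith) (by linarith))
  | (exfalso; exact d2 (by linarith) (by linarith) (by linarith) (by linarith))
  | simp [*]

lemma NH.ind {A B C D : ℝ × ℝ} (h : NH A B C D) : Indep2 (B - A) (D - A) := by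
  intro y w e
  rcases h.signs (x := -y - w) (y := y) (z := 0) (w := w) (by ring)
    (by rw [← e]; module) with h | h | h | h | h | h | h
  · exact ⟨h.2.1, h.2.2.2⟩
  all_goals (exfalso; have := h.2.2.1; exact lt_irrefl _ this)

lemma NH.mk_quad {A B C D : ℝ × ℝ} (h : NH A B C D)
    {x y z w : ℝ} (h0 : x + y + z + w = 0) (hv : x • A + y • B + z • C + w • D = 0)
    (hx : 0 < x) (hy : y < 0) (hz : 0 < z) (hw : w < 0) : Quad A B C D x (-y) z (-w) where
  ha := hx
  hb := by linarith
  hc := hz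
  hd := by linarith
  hs := by linarith
  hv := by linear_combination (norm := module) hv
  ind := h.ind

lemma NH.swap {A B C D : ℝ × ℝ} (h : NH A B C D) : NH A C B D := by
  obtain ⟨hA, hB, hC, hD⟩ := h
  exact ⟨by rwa [insert_comm], hC, hB, by rwa [pair_comm C B]⟩

lemma NH.swap' {A B C D : ℝ × ℝ} (h : NH A B C D) : NH A B D C := by
  obtain ⟨hA, hB, hC, hD⟩ := h
  exact ⟨by rwa [pair_comm], by rwa [pair_comm], hD, hC⟩

lemma exists_dep (A B C D : ℝ × ℝ) : ∃ x y z w : ℝ, x + y + z + w = 0 ∧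
    x • A + y • B + z • C + w • D = 0 ∧ ¬ (x = 0 ∧ y = 0 ∧ z = 0 ∧ w = 0) := by
  let P : Fin 4 → ℝ × ℝ := ![A, B, C, D]
  let L : (Fin 4 → ℝ) →ₗ[ℝ] (ℝ × ℝ) × ℝ :=
    (Fintype.linearCombination ℝ P).prod (Fintype.linearCombination ℝ (fun _ : Fin 4 => (1 : ℝ)))
  have hk : LinearMap.ker L ≠ ⊥ := LinearMap.ker_ne_bot_of_finrank_lt (by simp)
  obtain ⟨g, hg, hg0⟩ := (Submodule.ne_bot_iff _).1 hk
  have h := LinearMap.mem_ker.1 hg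
  have h1 : Fintype.linearCombination ℝ P g = 0 := congrArg Prod.fst h
  have h2 : Fintype.linearCombination ℝ (fun _ : Fin 4 => (1 : ℝ)) g = 0 := congrArg Prod.snd h
  simp only [P, Fintype.linearCombination_apply, Fin.sum_univ_four, smul_eq_mul, mul_one] at h1 h2
  refine ⟨g 0, g 1, g 2, g 3, h2, by simpa using h1, ?_⟩
  rintro ⟨h0, h1, h2, h3⟩
  apply hg0
  funext i
  fin_cases i <;> simp [*]

lemma exists_quad {Q : Set (ℝ × ℝ)} (hQ : IsConvexQuadrangle Q) :
    ∃ A B C D a b c d, Quad A B C D a b c d ∧ Q = convexHull ℝ {A, B, C, D} := by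
  obtain ⟨A, B, C, D, rfl, h⟩ := hQ
  change NH A B C D at h
  obtain ⟨x, y, z, w, h0, hv, hne⟩ := exists_dep A B C D
  have hv' : (-x) • A + (-y) • B + (-z) • C + (-w) • D = 0 := by
    linear_combination (norm := module) (-1 : ℝ) • hv
  have e1 : ({A, B, C, D} : Set (ℝ × ℝ)) = {A, C, B, D} := by rw [insert_comm B C]
  have e2 : ({A, B, C, D} : Set (ℝ × ℝ)) = {A, B, D, C} := by rw [pair_comm C D]
  rcases h.signs h0 hv with h' | ⟨i, j, k, l⟩ | ⟨i, j, k, l⟩ | ⟨i, j, k, l⟩ | ⟨i, j, k, l⟩ |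
    ⟨i, j, k, l⟩ | ⟨i, j, k, l⟩
  · exact absurd h' hne
  · exact ⟨_, _, _, _, _, _, _, _, h.swap.mk_quad (x := x) (y := z) (z := y) (w := w) (by linarith)
      (by rw [← hv]; module) i k j l, by rw [e1]⟩
  · exact ⟨_, _, _, _, _, _, _, _, h.mk_quad h0 hv i j k l, rfl⟩
  · exact ⟨_, _, _, _, _, _, _, _, h.swap'.mk_quad (x := x) (y := y) (z := w) (w := z) (by linarith)
      (by rw [← hv]; module) i j l k, by rw [e2]⟩
  · exact ⟨_, _, _, _, _, _, _, _, h.swap'.mk_quad (x := -x) (y := -y) (z := -w) (w := -z)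
      (by linarith) (by rw [← hv']; module) (by linarith) (by linarith) (by linarith)
      (by linarith), by rw [e2]⟩
  · exact ⟨_, _, _, _, _, _, _, _, h.mk_quad (x := -x) (y := -y) (z := -z) (w := -w)
      (by linarith) hv' (by linarith) (by linarith) (by linarith) (by linarith), rfl⟩
  · exact ⟨_, _, _, _, _, _, _, _, h.swap.mk_quad (x := -x) (y := -z) (z := -y) (w := -w)
      (by linarith) (by rw [← hv']; module) (by linarith) (by linarith) (by linarith)
      (by linarith), by rw [e1]⟩

section quad
variable {A B C D : ℝ × ℝ} {a b c d : ℝ}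

lemma Quad.rot (h : Quad A B C D a b c d) : Quad B C D A b c d a where
  ha := h.hb
  hb := h.hc
  hc := h.hd
  hd := h.ha
  hs := by linarith [h.hs]
  hv := by rw [← h.hv]; module
  ind := by
    intro y z e
    have e2 : (y * (b - c) - z * c) • (B - A) + (y * d) • (D - A) = 0 := by
      have hv := h.hv
      have hs := h.hs
      obtain rfl : a = b + d - c := by linarith
      linear_combination (norm := module) c • e - y • hv
    obtain ⟨h1, h2⟩ := h.ind _ _ e2
    have hy : y = 0 := by
      rcases mul_eq_zero.1 h2 with h | h'
      · exact h
      · exact absurd h' h.hd.ne'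
    refine ⟨hy, ?_⟩
    rw [hy] at h1
    have h3 : z * c = 0 := by linarith
    rcases mul_eq_zero.1 h3 with h | h'
    · exact h
    · exact absurd h' h.hc.ne'

/-- The other orientation of the vertices, keeping the pair of sides `AB`, `CD`. -/
lemma Quad.flip (h : Quad A B C D a b c d) : Quad B A D C b a d c where
  ha := h.hb
  hb := h.ha
  hc := h.hd
  hd := h.hc
  hs := by linarith [h.hs]
  hv := h.hv.symm
  ind := by
    intro y z e
    obtain ⟨h1, h2⟩ := h.rot.ind z y (by rw [← e]; module)
    exact ⟨h2, h1⟩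

lemma Quad.dep (h : Quad A B C D a b c d) {x y z w : ℝ} (h0 : x + y + z + w = 0)
    (hv : x • A + y • B + z • C + w • D = 0) :
    ∃ l : ℝ, x = l * a ∧ y = -(l * b) ∧ z = l * c ∧ w = -(l * d) := by
  have hc := h.hc.ne'
  have hs := h.hs
  have hz : z = z / c * c := by field_simp
  set l := z / c with hl
  have key : (y + l * b) • (B - A) + (w + l * d) • (D - A) = 0 := by
    have h2 := h.hv
    obtain rfl : a = b + d - c := by linarith
    obtain rfl : x = - (y + z + w) := by linarith
    rw [hz] at hv
    linear_combination (norm := module) hv - l • h2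
  obtain ⟨h1, h2⟩ := h.ind _ _ key
  refine ⟨l, ?_, by linarith, hz, by linarith⟩
  have : x = - (y + z + w) := by linarith
  obtain rfl : a = b + d - c := by linarith
  rw [this]
  linear_combination -h1 - h2 - hz

/-- The convex hull described by inequalities in the affine coordinates given by `A, B, D`. -/
lemma Quad.mem_hull (h : Quad A B C D a b c d) (X : ℝ × ℝ) :
    X ∈ convexHull ℝ ({A, B, C, D} : Set (ℝ × ℝ)) ↔
    ∃ x y : ℝ, X = A + x • (B - A) + y • (D - A) ∧ 0 ≤ x ∧ 0 ≤ y ∧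
      0 ≤ d * (1 - x) + (b - c) * y ∧ 0 ≤ b * (1 - y) + (d - c) * x := by
  have hc := h.hc
  have hb := h.hb
  have hd := h.hd
  have ha := h.ha
  have hs := h.hs
  have hv := h.hv
  obtain rfl : a = b + d - c := by linarith
  have hC : C = A + (b / c) • (B - A) + (d / c) • (D - A) := by
    have : c • C = c • (A + (b / c) • (B - A) + (d / c) • (D - A)) := by
      simp only [smul_add, smul_smul, mul_div_cancel₀ _ hc.ne']
      linear_combination (norm := module) hv
    exact smul_right_injective _ hc.ne' this
  rw [mem_hull4]
  constructor
  · rintro ⟨p, q, r, s, hp, hq, hr, hs', h1, rfl⟩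
    refine ⟨q + r * b / c, s + r * d / c, ?_, by positivity, by positivity, ?_, ?_⟩
    · obtain rfl : p = 1 - q - r - s := by linarith
      rw [hC]
      module
    · have : d * (1 - (q + r * b / c)) + (b - c) * (s + r * d / c) = p * d + s * (b + d - c) := by
        obtain rfl : p = 1 - q - r - s := by linarith
        field_simp
        ring
      rw [this]
      positivity
    · have : b * (1 - (s + r * d / c)) + (d - c) * (q + r * b / c) = p * b + q * (b + d - c) := by
        obtain rfl : p = 1 - q - r - s := by linarith
        field_simp
        ring
      rw [this]
      positivity
  · rintro ⟨x, y, rfl, hx, hy, h1, h2⟩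
    rcases le_total (x + y) 1 with hxy | hxy
    · exact ⟨1 - x - y, x, 0, y, by linarith, hx, le_rfl, hy, by ring, by module⟩
    · have hr : 0 ≤ (x + y - 1) / (b + d - c) := div_nonneg (by linarith) ha.le
      have hrr : (x + y - 1) / (b + d - c) * (b + d - c) = x + y - 1 := by field_simp
      set r := (x + y - 1) / (b + d - c) with hrdef
      refine ⟨0, x - r * b, r * c, y - r * d, le_rfl, ?_, by positivity, ?_, ?_, ?_⟩
      · have : (x - r * b) * (b + d - c) = b * (1 - y) + (d - c) * x := by
          linear_combination (-b) * hrr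
        by_contra hneg
        push Not at hneg
        nlinarith
      · have : (y - r * d) * (b + d - c) = d * (1 - x) + (b - c) * y := by
          linear_combination (-d) * hrr
        by_contra hneg
        push Not at hneg
        nlinarith
      · linear_combination -hrr
      · have e : (r * c) • C = (r * (b + d - c)) • (-A) + (r * b) • B + (r * d) • D := by
          linear_combination (norm := module) r • hv
        rw [hrr] at e
        rw [e]
        module

lemma hull_rot (A B C D : ℝ × ℝ) : ({A, B, C, D} : Set (ℝ × ℝ)) = {B, C, D, A} := by
  ext; simp only [mem_insert_iff, mem_singleton_iff]; tauto

lemma hull_flip (A B C D : ℝ × ℝ) : ({A, B, C, D} : Set (ℝ × ℝ)) = {B, A, D, C} := by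
  ext; simp only [mem_insert_iff, mem_singleton_iff]; tauto

lemma Quad.extreme (h : Quad A B C D a b c d) :
    A ∈ (convexHull ℝ ({A, B, C, D} : Set (ℝ × ℝ))).extremePoints ℝ := by
  rw [mem_extremePoints_iff_left]
  refine ⟨subset_convexHull _ _ (by simp), ?_⟩
  intro X hX Y hY hXY
  obtain ⟨x, y, rfl, hx, hy, -, -⟩ := (h.mem_hull X).1 hX
  obtain ⟨x', y', rfl, hx', hy', -, -⟩ := (h.mem_hull Y).1 hY
  obtain ⟨m, n, hm, hn, hmn, e⟩ := hXY
  obtain ⟨h1, h2⟩ := h.ind (m * x + n * x') (m * y + n * y') (by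
    obtain rfl : n = 1 - m := by linarith
    linear_combination (norm := module) e)
  have h3 : x = 0 := by nlinarith [mul_nonneg hm.le hx, mul_nonneg hn.le hx']
  have h4 : y = 0 := by nlinarith [mul_nonneg hm.le hy, mul_nonneg hn.le hy']
  simp [h3, h4]

lemma Quad.mem_of_hull_eq (h : Quad A B C D a b c d) {S : Set (ℝ × ℝ)}
    (e : convexHull ℝ ({A, B, C, D} : Set (ℝ × ℝ)) = convexHull ℝ S) :
    A ∈ S ∧ B ∈ S ∧ C ∈ S ∧ D ∈ S := by
  have key : ∀ {A B C D a b c d}, Quad A B C D a b c d →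
      convexHull ℝ ({A, B, C, D} : Set (ℝ × ℝ)) = convexHull ℝ S → A ∈ S := by
    intro A B C D a b c d h e
    apply extremePoints_convexHull_subset (𝕜 := ℝ)
    rw [← e]
    exact h.extreme
  refine ⟨key h e, key h.rot ?_, key h.rot.rot ?_, key h.rot.rot.rot ?_⟩
  · rw [← e, hull_rot A]
  · rw [← e, hull_rot A, hull_rot B]
  · rw [← e, hull_rot A, hull_rot B, hull_rot C]

lemma Quad.ne (h : Quad A B C D a b c d) : A ≠ B ∧ A ≠ C ∧ A ≠ D := by
  refine ⟨?_, ?_, ?_⟩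
  · rintro rfl
    have := (h.ind 1 0 (by simp)).1
    norm_num at this
  · rintro rfl
    obtain ⟨l, h1, h2, h3, h4⟩ := h.dep (x := 1) (y := 0) (z := -1) (w := 0) (by ring) (by module)
    have := h.ha
    have := h.hc
    have : 0 < l := by by_contra hl; push Not at hl; nlinarith
    nlinarith
  · rintro rfl
    have := (h.ind 0 1 (by simp)).2
    norm_num at this

lemma Quad.ne_all (h : Quad A B C D a b c d) : A ≠ B ∧ A ≠ C ∧ A ≠ D ∧ B ≠ C ∧ B ≠ D ∧ C ≠ D :=
  ⟨h.ne.1, h.ne.2.1, h.ne.2.2, h.rot.ne.1, h.rot.ne.2.1, h.rot.rot.ne.1⟩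

lemma Quad.not_mem (h : Quad A B C D a b c d) :
    A ∉ convexHull ℝ ({B, C, D} : Set (ℝ × ℝ)) := by
  intro hA
  obtain ⟨q, r, s, hq, hr, hs, h1, e⟩ := (mem_hull3 _ _ _ _).1 hA
  obtain ⟨l, h1, h2, h3, h4⟩ := h.dep (x := -1) (y := q) (z := r) (w := s) (by linarith)
    (by nth_rewrite 1 [e]; module)
  have := h.ha
  have := h.hc
  have : l < 0 := by by_contra hl; push Not at hl; nlinarith
  nlinarith

lemma Quad.nh (h : Quad A B C D a b c d) : NH A B C D := by
  refine ⟨h.not_mem, ?_, ?_, ?_⟩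
  · have := h.rot.not_mem
    rwa [pair_comm D A, insert_comm C A] at this
  · have := h.rot.rot.not_mem
    rwa [insert_comm D A, pair_comm D B] at this
  · exact h.rot.rot.rot.not_mem

lemma Quad.image (h : Quad A B C D a b c d) (φ : (ℝ × ℝ) ≃ᵃ[ℝ] (ℝ × ℝ)) :
    Quad (φ A) (φ B) (φ C) (φ D) a b c d where
  ha := h.ha
  hb := h.hb
  hc := h.hc
  hd := h.hd
  hs := h.hs
  hv := by
    have e : ∀ X, φ X = φ.linear X + φ 0 := fun X => by
      have := φ.map_vadd 0 X
      simpa using this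
    rw [e A, e B, e C, e D]
    have := congrArg φ.linear h.hv
    simp only [map_add, map_smul] at this
    have hs := h.hs
    obtain rfl : a = b + d - c := by linarith
    linear_combination (norm := module) this
  ind := by
    intro y z e
    apply h.ind
    apply φ.linear.injective
    have e1 : ∀ X Y, φ X - φ Y = φ.linear (X - Y) := fun X Y => by
      have := φ.toAffineMap.linearMap_vsub X Y
      simpa using this.symm
    rw [e1, e1] at e
    simpa using e

lemma image_hull4 (φ : (ℝ × ℝ) ≃ᵃ[ℝ] (ℝ × ℝ)) (A B C D : ℝ × ℝ) :
    φ '' convexHull ℝ {A, B, C, D} = convexHull ℝ {φ A, φ B, φ C, φ D} := by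
  have := φ.toAffineMap.image_convexHull {A, B, C, D}
  simpa [image_insert_eq] using this

lemma rho_aux (h : Quad A B C D a b c d) {B' C' D' : ℝ × ℝ} {a' b' c' d' : ℝ}
    (h' : Quad A B' C' D' a' b' c' d')
    (hB : B' ∈ ({A, B, C, D} : Set (ℝ × ℝ))) (hC : C' ∈ ({A, B, C, D} : Set (ℝ × ℝ)))
    (hD : D' ∈ ({A, B, C, D} : Set (ℝ × ℝ))) : b' * d' * (a * c) = b * d * (a' * c') := by
  obtain ⟨n1, n2, n3, n4, n5, n6⟩ := h'.ne_all
  simp only [mem_insert_iff, mem_singleton_iff] at hB hC hD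
  have ha := h.ha
  have hb := h.hb
  have hd := h.hd
  have ha' := h'.ha
  have hc' := h'.hc
  have hs' := h'.hs
  have hv' := h'.hv
  rcases hC with rfl | rfl | rfl | rfl
  · exact absurd rfl n2
  · exfalso
    rcases hB with rfl | rfl | rfl | rfl
    · exact absurd rfl n1
    · exact absurd rfl n4
    · rcases hD with rfl | rfl | rfl | rfl
      · exact absurd rfl n3
      · exact absurd rfl n6
      · exact absurd rfl n5
      · obtain ⟨l, h1, h2, -, -⟩ := h.dep (x := a') (y := c') (z := -b') (w := -d') (by linarith)
          (by linear_combination (norm := module) hv')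
        have : 0 < l := by by_contra hl; push Not at hl; nlinarith
        nlinarith
    · rcases hD with rfl | rfl | rfl | rfl
      · exact absurd rfl n3
      · exact absurd rfl n6
      · obtain ⟨l, h1, h2, -, -⟩ := h.dep (x := a') (y := c') (z := -d') (w := -b') (by linarith)
          (by linear_combination (norm := module) hv')
        have : 0 < l := by by_contra hl; push Not at hl; nlinarith
        nlinarith
      · exact absurd rfl n5
  · rcases hB with rfl | rfl | rfl | rfl
    · exact absurd rfl n1
    · rcases hD with rfl | rfl | rfl | rfl
      · exact absurd rfl n3
      · exact absurd rfl n5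
      · exact absurd rfl n6
      · obtain ⟨l, h1, h2, h3, h4⟩ := h.dep (x := a') (y := -b') (z := c') (w := -d') (by linarith)
          (by linear_combination (norm := module) hv')
        obtain rfl : b' = l * b := by linarith
        obtain rfl : d' = l * d := by linarith
        rw [h1, h3]; ring
    · exact absurd rfl n4
    · rcases hD with rfl | rfl | rfl | rfl
      · exact absurd rfl n3
      · obtain ⟨l, h1, h2, h3, h4⟩ := h.dep (x := a') (y := -d') (z := c') (w := -b') (by linarith)
          (by linear_combination (norm := module) hv')
        obtain rfl : d' = l * b := by linarith
        obtain rfl : b' = l * d := by linarith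
        rw [h1, h3]; ring
      · exact absurd rfl n6
      · exact absurd rfl n5
  · exfalso
    rcases hB with rfl | rfl | rfl | rfl
    · exact absurd rfl n1
    · rcases hD with rfl | rfl | rfl | rfl
      · exact absurd rfl n3
      · exact absurd rfl n5
      · obtain ⟨l, h1, -, -, h2⟩ := h.dep (x := a') (y := -b') (z := -d') (w := c') (by linarith)
          (by linear_combination (norm := module) hv')
        have : 0 < l := by by_contra hl; push Not at hl; nlinarith
        nlinarith
      · exact absurd rfl n6
    · rcases hD with rfl | rfl | rfl | rfl
      · exact absurd rfl n3
      · obtain ⟨l, h1, -, -, h2⟩ := h.dep (x := a') (y := -d') (z := -b') (w := c') (by linarith)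
          (by linear_combination (norm := module) hv')
        have : 0 < l := by by_contra hl; push Not at hl; nlinarith
        nlinarith
      · exact absurd rfl n5
      · exact absurd rfl n6
    · exact absurd rfl n4

lemma rho_inv (h : Quad A B C D a b c d) {A' B' C' D' : ℝ × ℝ} {a' b' c' d' : ℝ}
    (h' : Quad A' B' C' D' a' b' c' d')
    (hA : A' ∈ ({A, B, C, D} : Set (ℝ × ℝ)))
    (hB : B' ∈ ({A, B, C, D} : Set (ℝ × ℝ))) (hC : C' ∈ ({A, B, C, D} : Set (ℝ × ℝ)))
    (hD : D' ∈ ({A, B, C, D} : Set (ℝ × ℝ))) :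
    b' * d' * (a * c) = b * d * (a' * c') ∨ b' * d' * (b * d) = a * c * (a' * c') := by
  have hA2 := hA
  simp only [mem_insert_iff, mem_singleton_iff] at hA2
  rcases hA2 with rfl | rfl | rfl | rfl
  · left; exact rho_aux h h' hB hC hD
  · right
    rw [hull_rot] at hB hC hD
    have := rho_aux h.rot h' hB hC hD
    linear_combination this
  · left
    rw [hull_rot, hull_rot B] at hB hC hD
    have := rho_aux h.rot.rot h' hB hC hD
    linear_combination this
  · right
    rw [hull_rot, hull_rot B, hull_rot C] at hB hC hD
    have := rho_aux h.rot.rot.rot h' hB hC hD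
    linear_combination this

end quad

section cut
variable {A B C D A' B' C' D' : ℝ × ℝ} {a b c d a' b' c' d' : ℝ}

/-- A line cannot cut off a single vertex. -/
lemma cut_tri (h : Quad A B C D a b c d) (h' : Quad A' B' C' D' a' b' c' d')
    (f : (ℝ × ℝ) →L[ℝ] ℝ) (u : ℝ)
    (e : convexHull ℝ ({A', B', C', D'} : Set (ℝ × ℝ)) =
      convexHull ℝ ({A, B, C, D} : Set (ℝ × ℝ)) ∩ {X | f X ≤ u})
    (hA : f A < u) (hB : u ≤ f B) (hD : u ≤ f D) : False := by
  have hAB : 0 < f B - f A := by linarith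
  have hAD : 0 < f D - f A := by linarith
  have huA : 0 < u - f A := by linarith
  set k := (u - f A) / (f B - f A) with hk
  set m := (u - f A) / (f D - f A) with hm
  have k0 : 0 < k := div_pos huA hAB
  have m0 : 0 < m := div_pos huA hAD
  have k1 : k ≤ 1 := by rw [hk, div_le_one hAB]; linarith
  have m1 : m ≤ 1 := by rw [hm, div_le_one hAD]; linarith
  have kk : k * (f B - f A) = u - f A := by rw [hk]; field_simp
  have mm : m * (f D - f A) = u - f A := by rw [hm]; field_simp
  have key : convexHull ℝ ({A', B', C', D'} : Set (ℝ × ℝ)) =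
      convexHull ℝ ({A, A + k • (B - A), A + m • (D - A)} : Set (ℝ × ℝ)) := by
    rw [e]
    apply Subset.antisymm
    · rintro X ⟨hX, hfX⟩
      obtain ⟨x, y, rfl, hx, hy, -, -⟩ := (h.mem_hull X).1 hX
      simp only [mem_ofPred_eq, map_add, map_smul, map_sub, smul_eq_mul] at hfX
      rw [mem_hull3]
      refine ⟨1 - x / k - y / m, x / k, y / m, ?_, by positivity, by positivity, by ring, ?_⟩
      · have e1 : x / k * (u - f A) = x * (f B - f A) := by rw [← kk]; field_simp
        have e2 : y / m * (u - f A) = y * (f D - f A) := by rw [← mm]; field_simp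
        by_contra hneg
        push Not at hneg
        nlinarith
      · have e1 : (x / k) * k = x := by field_simp
        have e2 : (y / m) * m = y := by field_simp
        calc A + x • (B - A) + y • (D - A) = A + ((x / k) * k) • (B - A) + ((y / m) * m) • (D - A) := by
              rw [e1, e2]
          _ = _ := by module
    · apply convexHull_min
      · intro X hX
        simp only [mem_insert_iff, mem_singleton_iff] at hX
        rcases hX with rfl | rfl | rfl
        · exact ⟨subset_convexHull _ _ (by simp), hA.le⟩
        · refine ⟨(mem_hull4 _ _ _ _ _).2 ⟨1 - k, k, 0, 0, by linarith, k0.le, le_rfl, le_rfl,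
            by ring, by module⟩, ?_⟩
          simp only [mem_ofPred_eq, map_add, map_smul, map_sub, smul_eq_mul]
          linarith
        · refine ⟨(mem_hull4 _ _ _ _ _).2 ⟨1 - m, 0, 0, m, by linarith, le_rfl, le_rfl, m0.le,
            by ring, by module⟩, ?_⟩
          simp only [mem_ofPred_eq, map_add, map_smul, map_sub, smul_eq_mul]
          linarith
      · exact (convex_convexHull _ _).inter (convex_halfSpace_le f.toLinearMap.isLinear u)
  obtain ⟨i1, i2, i3, i4⟩ := h'.mem_of_hull_eq key
  obtain ⟨n1, n2, n3, n4, n5, n6⟩ := h'.ne_all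
  simp only [mem_insert_iff, mem_singleton_iff] at i1 i2 i3 i4
  rcases i1 with i1 | i1 | i1 <;> rcases i2 with i2 | i2 | i2 <;>
  rcases i3 with i3 | i3 | i3 <;> rcases i4 with i4 | i4 | i4 <;>
  first
  | exact n1 (i1.trans i2.symm)
  | exact n2 (i1.trans i3.symm)
  | exact n3 (i1.trans i4.symm)
  | exact n4 (i2.trans i3.symm)
  | exact n5 (i2.trans i4.symm)
  | exact n6 (i3.trans i4.symm)

/-- A line cutting two opposite sides: consequence for the affine invariant. -/
lemma cut_opp (h : Quad A B C D a b c d) (h' : Quad A' B' C' D' a b c d)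
    (f : (ℝ × ℝ) →L[ℝ] ℝ) (u : ℝ)
    (e : convexHull ℝ ({A', B', C', D'} : Set (ℝ × ℝ)) =
      convexHull ℝ ({A, B, C, D} : Set (ℝ × ℝ)) ∩ {X | f X ≤ u})
    (hA : f A < u) (hD : f D < u) (hB : u < f B) (hC : u < f C)
    {s t : ℝ} (hs : s * (f B - f A) = u - f A) (ht : t * (f C - f D) = u - f D) :
    b * d * (c * (a * s + b * (1 - s))) = a * c * (b * (d * t + c * (1 - t))) ∨
    b * d * (b * (d * t + c * (1 - t))) = a * c * (c * (a * s + b * (1 - s))) := by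
  have s0 : 0 < s := by by_contra hl; push Not at hl; nlinarith
  have s1 : s < 1 := by by_contra hl; push Not at hl; nlinarith
  have t0 : 0 < t := by by_contra hl; push Not at hl; nlinarith
  have t1 : t < 1 := by by_contra hl; push Not at hl; nlinarith
  have s1' : 0 < 1 - s := by linarith
  have t1' : 0 < 1 - t := by linarith
  have ha := h.ha
  have hb := h.hb
  have hc := h.hc
  have hd := h.hd
  have hsum := h.hs
  have hv := h.hv
  -- weights multiplied by `s * t`
  have q : Quad A (A + s • (B - A)) (D + t • (C - D)) D (t * (a * s + b * (1 - s))) (b * t) (c * s)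
      (s * (d * t + c * (1 - t))) := by
    refine ⟨by positivity, by positivity, by positivity, by positivity, ?_, ?_, ?_⟩
    · linear_combination s * t * hsum
    · linear_combination (norm := module) (s * t) • hv
    · intro y z e
      obtain ⟨h1, h2⟩ := h.ind (y * s) z (by rw [← e]; module)
      refine ⟨?_, h2⟩
      rcases mul_eq_zero.1 h1 with h | h
      · exact h
      · exact absurd h s0.ne'
  have key : convexHull ℝ ({A', B', C', D'} : Set (ℝ × ℝ)) =
      convexHull ℝ ({A, A + s • (B - A), D + t • (C - D), D} : Set (ℝ × ℝ)) := by
    rw [e]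
    apply Subset.antisymm
    · rintro X ⟨hX, hfX⟩
      obtain ⟨x, y, rfl, hx, hy, c1, c2⟩ := (h.mem_hull X).1 hX
      simp only [mem_ofPred_eq, map_add, map_smul, map_sub, smul_eq_mul] at hfX
      rw [q.mem_hull]
      have hxs : x / s * s = x := by field_simp
      refine ⟨x / s, y, ?_, by positivity, hy, ?_, ?_⟩
      · calc A + x • (B - A) + y • (D - A) = A + (x / s * s) • (B - A) + y • (D - A) := by rw [hxs]
          _ = _ := by module
      · have hfv := congrArg f q.hv
        simp only [map_add, map_smul, map_sub, smul_eq_mul] at hfv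
        have hu : 0 < u - f A := by linarith
        have hg : s * (d * t + c * (1 - t)) * (f D - f A) = (c * s - b * t) * (u - f A) := by
          have hq := q.hs
          obtain rfl : a = b + d - c := by linarith
          linear_combination -hfv + c * s * ht - b * t * hs
        have hxf : x * (f B - f A) = x / s * (u - f A) := by rw [← hs]; field_simp
        have hw : 0 ≤ s * (d * t + c * (1 - t)) := by positivity
        have h3 : 0 ≤ s * (d * t + c * (1 - t)) * (u - f A - x * (f B - f A) - y * (f D - f A)) :=
          mul_nonneg hw (by linarith)
        rw [hxf] at h3
        have h4 : 0 ≤ (s * (d * t + c * (1 - t)) * (1 - x / s) + (b * t - c * s) * y) * (u - f A) := by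
          have : (s * (d * t + c * (1 - t)) * (1 - x / s) + (b * t - c * s) * y) * (u - f A) =
             s * (d * t + c * (1 - t)) * (u - f A - x / s * (u - f A) - y * (f D - f A)) := by
            linear_combination y * hg
          rw [this]; exact h3
        exact nonneg_of_mul_nonneg_left h4 hu
      · have : b * t * (1 - y) + (s * (d * t + c * (1 - t)) - c * s) * (x / s) =
            t * (b * (1 - y) + (d - c) * x) := by
          field_simp
          ring
        rw [this]
        positivity
    · apply convexHull_min
      · intro X hX
        simp only [mem_insert_iff, mem_singleton_iff] at hX
        rcases hX with rfl | rfl | rfl | rfl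
        · exact ⟨subset_convexHull _ _ (by simp), hA.le⟩
        · refine ⟨(mem_hull4 _ _ _ _ _).2 ⟨1 - s, s, 0, 0, by linarith, s0.le, le_rfl, le_rfl,
            by ring, by module⟩, ?_⟩
          simp only [mem_ofPred_eq, map_add, map_smul, map_sub, smul_eq_mul]
          linarith
        · refine ⟨(mem_hull4 _ _ _ _ _).2 ⟨0, 0, t, 1 - t, le_rfl, le_rfl, t0.le, by linarith,
            by ring, by module⟩, ?_⟩
          simp only [mem_ofPred_eq, map_add, map_smul, map_sub, smul_eq_mul]
          linarith
        · exact ⟨subset_convexHull _ _ (by simp), hD.le⟩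
      · exact (convex_convexHull _ _).inter (convex_halfSpace_le f.toLinearMap.isLinear u)
  obtain ⟨i1, i2, i3, i4⟩ := h'.mem_of_hull_eq key
  have st : s * t ≠ 0 := by positivity
  rcases rho_inv q h' i1 i2 i3 i4 with r | r
  · left
    apply mul_left_cancel₀ st
    linear_combination r
  · right
    apply mul_left_cancel₀ st
    linear_combination r

/-- Pieces of a cut. -/
def Pieces (A B C D : ℝ × ℝ) (a b c d : ℝ) (f : (ℝ × ℝ) →L[ℝ] ℝ) (u : ℝ) : Prop :=
  ∃ A' B' C' D', Quad A' B' C' D' a b c d ∧ convexHull ℝ ({A', B', C', D'} : Set (ℝ × ℝ)) =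
      convexHull ℝ ({A, B, C, D} : Set (ℝ × ℝ)) ∩ {X | f X ≤ u}

lemma Pieces.rot {f u} (h : Pieces A B C D a b c d f u) : Pieces B C D A b c d a f u := by
  obtain ⟨A', B', C', D', q, e⟩ := h
  exact ⟨B', C', D', A', q.rot, by rw [← hull_rot, e, ← hull_rot A]⟩

lemma Pieces.flip {f u} (h : Pieces A B C D a b c d f u) : Pieces B A D C b a d c f u := by
  obtain ⟨A', B', C', D', q, e⟩ := h
  exact ⟨B', A', D', C', q.flip, by rw [← hull_flip, e, ← hull_flip A]⟩

lemma Pieces.tri {f u} (h : Pieces A B C D a b c d f u) (q : Quad A B C D a b c d)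
    (hA : f A < u) (hB : u ≤ f B) (hD : u ≤ f D) : False := by
  obtain ⟨A', B', C', D', q', e⟩ := h
  exact cut_tri q q' f u e hA hB hD

lemma rho_arith {a b c d p r : ℝ} (ha : 0 < a) (hb : 0 < b) (hc : 0 < c) (hd : 0 < d)
    (hp : 0 < p) (hr : 0 < r)
    (h1 : b * d * (c * p) = a * c * (b * r) ∨ b * d * (b * r) = a * c * (c * p))
    (h2 : a * c * (d * p) = b * d * (a * r) ∨ a * c * (a * r) = b * d * (d * p)) :
    a * c = b * d := by
  rcases h1 with h1 | h1
  · have h1' : d * p = a * r := mul_left_cancel₀ (mul_pos hb hc).ne' (by linear_combination h1)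
    rcases h2 with h2 | h2
    · rw [h1'] at h2
      exact mul_right_cancel₀ (mul_pos ha hr).ne' h2
    · rw [h1'] at h2
      exact mul_right_cancel₀ (mul_pos ha hr).ne' h2
  · rcases h2 with h2 | h2
    · have h2' : c * p = b * r := mul_left_cancel₀ (mul_pos ha hd).ne' (by linear_combination h2)
      rw [h2'] at h1
      exact (mul_right_cancel₀ (mul_pos hb hr).ne' h1).symm
    · have e : p * r * (a * c) ^ 3 = p * r * (b * d) ^ 3 := by
        linear_combination (-(a ^ 2 * c * r)) * h1 + (b ^ 2 * d * r) * h2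
      have e' := mul_left_cancel₀ (mul_pos hp hr).ne' e
      exact (pow_left_inj₀ (by positivity) (by positivity) (by norm_num)).1 e'

lemma opp_final {f : (ℝ × ℝ) →L[ℝ] ℝ} {u : ℝ} (q : Quad A B C D a b c d)
    (h1 : Pieces A B C D a b c d f u) (h2 : Pieces A B C D a b c d (-f) (-u))
    (hA : f A < u) (hD : f D < u) (hB : u < f B) (hC : u < f C) : a * c = b * d := by
  obtain ⟨A1, B1, C1, D1, q1, e1⟩ := h1
  obtain ⟨A2, B2, C2, D2, q2, e2⟩ := h2.flip
  have hs : (u - f A) / (f B - f A) * (f B - f A) = u - f A :=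
    div_mul_cancel₀ _ (by linarith)
  have ht : (u - f D) / (f C - f D) * (f C - f D) = u - f D :=
    div_mul_cancel₀ _ (by linarith)
  set s := (u - f A) / (f B - f A)
  set t := (u - f D) / (f C - f D)
  have s0 : 0 < s := by by_contra hl; push Not at hl; nlinarith
  have s1 : s < 1 := by by_contra hl; push Not at hl; nlinarith
  have t0 : 0 < t := by by_contra hl; push Not at hl; nlinarith
  have t1 : t < 1 := by by_contra hl; push Not at hl; nlinarith
  have s1' : 0 < 1 - s := by linarith
  have t1' : 0 < 1 - t := by linarith
  have r1 := cut_opp q q1 f u e1 hA hD hB hC hs ht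
  have r2 := cut_opp q.flip q2 (-f) (-u) e2 (by simpa using hB) (by simpa using hC)
    (by simpa using hA) (by simpa using hD) (s := 1 - s) (t := 1 - t)
    (by simp only [neg_apply]; linear_combination -hs)
    (by simp only [neg_apply]; linear_combination -ht)
  have ha := q.ha
  have hb := q.hb
  have hc := q.hc
  have hd := q.hd
  refine rho_arith (p := a * s + b * (1 - s)) (r := d * t + c * (1 - t)) ha hb hc hd
    (by positivity) (by positivity) r1 ?_
  rcases r2 with r | r
  · left; linear_combination r
  · right; linear_combination r

lemma from_A {f : (ℝ × ℝ) →L[ℝ] ℝ} {u : ℝ} (q : Quad A B C D a b c d)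
    (h1 : Pieces A B C D a b c d f u) (h2 : Pieces A B C D a b c d (-f) (-u))
    (hA : f A < u) (hpos : u < f B ∨ u < f C ∨ u < f D) : a * c = b * d := by
  have hv := congrArg f q.hv
  simp only [map_add, map_smul, smul_eq_mul] at hv
  have ha := q.ha
  have hb := q.hb
  have hc := q.hc
  have hd := q.hd
  have hs := q.hs
  rcases lt_or_ge (f B) u with hB | hB
  · rcases lt_or_ge (f D) u with hD | hD
    · have hC : u < f C := by rcases hpos with h | h | h <;> linarith
      exact (h2.rot.rot.tri q.rot.rot (by simpa using hC) (by simpa using hD.le)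
        (by simpa using hB.le)).elim
    · rcases lt_or_ge (f C) u with hC | hC
      · have hD : u < f D := by rcases hpos with h | h | h <;> linarith
        exact (h2.rot.rot.rot.tri q.rot.rot.rot (by simpa using hD) (by simpa using hA.le)
          (by simpa using hC.le)).elim
      · rcases eq_or_lt_of_le hD with hD | hD
        · have hC : u < f C := by rcases hpos with h | h | h <;> linarith
          exact (h2.rot.rot.tri q.rot.rot (by simpa using hC) (by simpa using hD.ge)
            (by simpa using hB.le)).elim
        · rcases eq_or_lt_of_le hC with hC | hC
          · exact (h2.rot.rot.rot.tri q.rot.rot.rot (by simpa using hD) (by simpa using hA.le)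
              (by simpa using hC.ge)).elim
          · have := opp_final q.rot h1.rot h2.rot hB hA hC hD
            linarith
  · rcases lt_or_ge (f D) u with hD | hD
    · rcases lt_or_ge (f C) u with hC | hC
      · have hB : u < f B := by rcases hpos with h | h | h <;> linarith
        exact (h2.rot.tri q.rot (by simpa using hB) (by simpa using hC.le)
          (by simpa using hA.le)).elim
      · rcases eq_or_lt_of_le hB with hB | hB
        · have hC : u < f C := by rcases hpos with h | h | h <;> linarith
          exact (h2.rot.rot.tri q.rot.rot (by simpa using hC) (by simpa using hD.le)
            (by simpa using hB.ge)).elim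
        · rcases eq_or_lt_of_le hC with hC | hC
          · exact (h2.rot.tri q.rot (by simpa using hB) (by simpa using hC.ge)
              (by simpa using hA.le)).elim
          · exact opp_final q h1 h2 hA hD hB hC
    · exact (h1.tri q hA hB hD).elim

lemma from_any {f : (ℝ × ℝ) →L[ℝ] ℝ} {u : ℝ} (q : Quad A B C D a b c d)
    (h1 : Pieces A B C D a b c d f u) (h2 : Pieces A B C D a b c d (-f) (-u))
    (hneg : f A < u ∨ f B < u ∨ f C < u ∨ f D < u)
    (hpos : u < f A ∨ u < f B ∨ u < f C ∨ u < f D) : a * c = b * d := by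
  rcases hneg with h | h | h | h
  · exact from_A q h1 h2 h (hpos.resolve_left h.not_gt)
  · have := from_A q.rot h1.rot h2.rot h (by
      rcases hpos with h' | h' | h' | h'
      · simp [h']
      · linarith
      · simp [h']
      · simp [h'])
    linarith
  · have := from_A q.rot.rot h1.rot.rot h2.rot.rot h (by
      rcases hpos with h' | h' | h' | h'
      · simp [h']
      · simp [h']
      · linarith
      · simp [h'])
    linarith
  · have := from_A q.rot.rot.rot h1.rot.rot.rot h2.rot.rot.rot h (by
      rcases hpos with h' | h' | h' | h'
      · simp [h']
      · simp [h']
      · simp [h']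
      · linarith)
    linarith

end cut

lemma exists_affT {v w : ℝ × ℝ} (h : Indep2 v w) (A : ℝ × ℝ) :
    ∃ T : (ℝ × ℝ) ≃ᵃ[ℝ] (ℝ × ℝ), ∀ x y : ℝ, T (x, y) = A + x • v + y • w := by
  let L : (ℝ × ℝ) →ₗ[ℝ] (ℝ × ℝ) :=
    (LinearMap.fst ℝ ℝ ℝ).smulRight v + (LinearMap.snd ℝ ℝ ℝ).smulRight w
  have hL : Function.Injective L := by
    rw [injective_iff_map_eq_zero]
    rintro ⟨x, y⟩ hxy
    obtain ⟨h1, h2⟩ := h x y (by simpa [L] using hxy)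
    simp [h1, h2]
  refine ⟨(LinearEquiv.ofInjectiveEndo L hL).toAffineEquiv.trans (AffineEquiv.constVAdd ℝ _ A), ?_⟩
  intro x y
  simp [L, add_assoc]

lemma affine_image_interior (T : (ℝ × ℝ) ≃ᵃ[ℝ] (ℝ × ℝ)) (S : Set (ℝ × ℝ)) :
    T '' interior S = interior (T '' S) := by
  exact (AffineEquiv.toContinuousAffineEquiv T).toHomeomorph.image_interior S

lemma Quad.interior_nonempty {A B C D : ℝ × ℝ} {a b c d : ℝ} (h : Quad A B C D a b c d) :
    (interior (convexHull ℝ ({A, B, C, D} : Set (ℝ × ℝ)))).Nonempty := by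
  obtain ⟨T, hT⟩ := exists_affT h.ind A
  let U : Set (ℝ × ℝ) := {p | 0 < p.1 ∧ 0 < p.2 ∧ p.1 + p.2 < 1}
  have hU : IsOpen U := by
    apply (isOpen_lt continuous_const continuous_fst).inter
    apply (isOpen_lt continuous_const continuous_snd).inter
    exact isOpen_lt (continuous_fst.add continuous_snd) continuous_const
  have hTU : IsOpen (T '' U) := by
    have := affine_image_interior T U
    rw [hU.interior_eq] at this
    rw [this]; exact isOpen_interior
  have hsub : T '' U ⊆ convexHull ℝ ({A, B, C, D} : Set (ℝ × ℝ)) := by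
    rintro _ ⟨⟨x, y⟩, ⟨h1, h2, h3⟩, rfl⟩
    simp only at h1 h2 h3
    rw [hT, mem_hull4]
    exact ⟨1 - x - y, x, 0, y, by linarith, h1.le, le_rfl, h2.le, by ring, by module⟩
  exact ⟨T (1/3, 1/3), interior_maximal hsub hTU ⟨(1/3, 1/3), by
    refine ⟨?_, ?_, ?_⟩ <;> norm_num, rfl⟩⟩

lemma piece_eq {Q Q₁ Q₂ : Set (ℝ × ℝ)} {f : (ℝ × ℝ) →L[ℝ] ℝ} {u : ℝ} (hQ : Convex ℝ Q)
    (hu : Q₁ ∪ Q₂ = Q) (hc : IsClosed Q₁) (h1 : ∀ x ∈ Q₁, f x ≤ u) (h2 : ∀ x ∈ Q₂, u ≤ f x)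
    {Y : ℝ × ℝ} (hY : Y ∈ Q) (hfY : f Y < u) : Q₁ = Q ∩ {X | f X ≤ u} := by
  apply Subset.antisymm
  · intro x hx
    exact ⟨hu ▸ Or.inl hx, h1 x hx⟩
  · rintro X ⟨hX, hfX⟩
    have hfX' : f X ≤ u := hfX
    have hsub : openSegment ℝ Y X ⊆ Q₁ := by
      intro Z hZ
      have hZQ : Z ∈ Q := hQ.openSegment_subset hY hX hZ
      obtain ⟨m, n, hm, hn, hmn, rfl⟩ := hZ
      rw [← hu] at hZQ
      rcases hZQ with h | h
      · exact h
      · exfalso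
        have := h2 _ h
        simp only [map_add, map_smul, smul_eq_mul] at this
        have k1 : m * f Y < m * u := mul_lt_mul_of_pos_left hfY hm
        have k2 : n * f X ≤ n * u := mul_le_mul_of_nonneg_left hfX' hn.le
        have k3 : m * u + n * u = u := by rw [← add_mul, hmn, one_mul]
        linarith
    have : X ∈ closure (openSegment ℝ Y X) := by
      rw [closure_openSegment]
      exact right_mem_segment _ _ _
    exact hc.closure_subset_iff.2 hsub this

lemma exists_vertex_lt {A B C D X : ℝ × ℝ} {f : (ℝ × ℝ) →L[ℝ] ℝ} {u : ℝ}
    (hX : X ∈ convexHull ℝ ({A, B, C, D} : Set (ℝ × ℝ))) (hf : f X < u) :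
    f A < u ∨ f B < u ∨ f C < u ∨ f D < u := by
  by_contra hcon
  push Not at hcon
  obtain ⟨p, q, r, s, hp, hq, hr, hs, h1, rfl⟩ := (mem_hull4 _ _ _ _ _).1 hX
  simp only [map_add, map_smul, smul_eq_mul] at hf
  obtain ⟨i, j, k, l⟩ := hcon
  have k3 : p * u + q * u + r * u + s * u = u := by
    rw [← add_mul, ← add_mul, ← add_mul, h1, one_mul]
  linarith [mul_le_mul_of_nonneg_left i hp, mul_le_mul_of_nonneg_left j hq,
    mul_le_mul_of_nonneg_left k hr, mul_le_mul_of_nonneg_left l hs]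

lemma forward {Q : Set (ℝ × ℝ)} (hQ : IsConvexQuadrangle Q) (h : IsSelfAffine 2 Q) :
    IsTrapezoid Q := by
  obtain ⟨A, B, C, D, a, b, c, d, q, rfl⟩ := exists_quad hQ
  obtain ⟨φ, hU, hdisj⟩ := h
  have hd : Disjoint _ _ := hdisj (show (0 : Fin 2) ≠ 1 by decide)
  set Q := convexHull ℝ ({A, B, C, D} : Set (ℝ × ℝ)) with hQdef
  have hU' : φ 0 '' Q ∪ φ 1 '' Q = Q := by
    refine Eq.trans ?_ hU
    ext x
    simp only [mem_iUnion, Fin.exists_fin_two, mem_union]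
  have hconv : ∀ i, Convex ℝ (φ i '' Q) := fun i => by
    rw [hQdef, image_hull4]; exact convex_convexHull _ _
  have hclosed : ∀ i, IsClosed (φ i '' Q) := fun i => by
    rw [hQdef, image_hull4]
    exact ((Set.toFinite _).isCompact_convexHull (𝕜 := ℝ)).isClosed
  have hInt : ∀ i, (interior (φ i '' Q)).Nonempty := fun i => by
    rw [hQdef, image_hull4]; exact (q.image (φ i)).interior_nonempty
  obtain ⟨f, u, hf0, hf1⟩ := geometric_hahn_banach_open_open (hconv 0).interior isOpen_interior
    (hconv 1).interior isOpen_interior hd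
  have hcl : ∀ i, φ i '' Q ⊆ closure (interior (φ i '' Q)) := fun i => by
    rw [(hconv i).closure_interior_eq_closure_of_nonempty_interior (hInt i)]
    exact subset_closure
  have g0 : ∀ x ∈ φ 0 '' Q, f x ≤ u := by
    intro x hx
    have hcl2 : closure (interior (φ 0 '' Q)) ⊆ {x | f x ≤ u} :=
      closure_minimal (fun y hy => (hf0 y hy).le) (isClosed_le f.continuous continuous_const)
    exact hcl2 (hcl 0 hx)
  have g1 : ∀ x ∈ φ 1 '' Q, u ≤ f x := by
    intro x hx
    have hcl2 : closure (interior (φ 1 '' Q)) ⊆ {x | u ≤ f x} :=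
      closure_minimal (fun y hy => (hf1 y hy).le) (isClosed_le continuous_const f.continuous)
    exact hcl2 (hcl 1 hx)
  obtain ⟨Y0, hY0⟩ := hInt 0
  obtain ⟨Y1, hY1⟩ := hInt 1
  have mY0 : Y0 ∈ Q := hU' ▸ Or.inl (interior_subset hY0)
  have mY1 : Y1 ∈ Q := hU' ▸ Or.inr (interior_subset hY1)
  have lY0 := hf0 _ hY0
  have lY1 := hf1 _ hY1
  have e0 := piece_eq (convex_convexHull ℝ _) hU' (hclosed 0) g0 g1 mY0 lY0
  have e1 := piece_eq (f := -f) (u := -u) (convex_convexHull ℝ _) ((union_comm _ _).trans hU')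
    (hclosed 1) (fun x hx => by simpa using g1 x hx) (fun x hx => by simpa using g0 x hx) mY1
    (by simpa using lY1)
  have p0 : Pieces A B C D a b c d f u :=
    ⟨_, _, _, _, q.image (φ 0), by rw [← image_hull4]; exact e0⟩
  have p1 : Pieces A B C D a b c d (-f) (-u) :=
    ⟨_, _, _, _, q.image (φ 1), by rw [← image_hull4]; exact e1⟩
  have hneg := exists_vertex_lt mY0 lY0
  have hpos := exists_vertex_lt (f := -f) (u := -u) mY1 (by simpa using lY1)
  have key : a * c = b * d := from_any q p0 p1 hneg (by simpa using hpos)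
  have ha := q.ha
  have hb := q.hb
  have hc := q.hc
  have hd' := q.hd
  have hs := q.hs
  have hv := q.hv
  have hac : 0 < a + c := by linarith
  refine ⟨A, B, C, D, hQdef, q.nh.1, q.nh.2.1, q.nh.2.2.1, q.nh.2.2.2, ?_, ?_⟩
  · refine ⟨(1 / (a + c)) • (a • A + c • C), ⟨a / (a + c), c / (a + c), by positivity,
      by positivity, by field_simp, by module⟩, ?_⟩
    rw [hv, hs]
    have : 0 < b + d := by linarith
    exact ⟨b / (b + d), d / (b + d), by positivity, by positivity, by field_simp, by module⟩
  · have hprod : (a - b) * (a - d) = 0 := by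
      obtain rfl : c = b + d - a := by linarith
      linear_combination -key
    rcases mul_eq_zero.1 hprod with h | h
    · left
      obtain rfl : a = b := by linarith
      obtain rfl : c = d := by linarith
      refine ⟨a / c, ?_⟩
      apply smul_right_injective _ hc.ne'
      simp only [smul_smul, mul_div_cancel₀ _ hc.ne']
      linear_combination (norm := module) hv
    · right
      obtain rfl : a = d := by linarith
      obtain rfl : c = b := by linarith
      refine ⟨-(c / a), ?_⟩
      apply smul_right_injective _ ha.ne'
      simp only [smul_smul, mul_neg, mul_div_cancel₀ _ ha.ne']
      linear_combination (norm := module) hv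

lemma IsSelfAffine.image {n : ℕ} {P : Set (ℝ × ℝ)} (h : IsSelfAffine n P)
    (T : (ℝ × ℝ) ≃ᵃ[ℝ] (ℝ × ℝ)) : IsSelfAffine n (T '' P) := by
  obtain ⟨φ, hU, hd⟩ := h
  have e : ∀ i, ((T.symm.trans (φ i)).trans T) '' (T '' P) = T '' (φ i '' P) := by
    intro i
    simp only [image_image]
    apply image_congr
    intro x _
    simp
  refine ⟨fun i => (T.symm.trans (φ i)).trans T, ?_, ?_⟩
  · simp only [e]
    rw [← image_iUnion, hU]
  · intro i j hij
    have := hd hij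
    simp only [e]
    rw [← affine_image_interior T (φ i '' P), ← affine_image_interior T (φ j '' P)]
    exact (disjoint_image_iff T.injective).2 this

lemma std_quad {t : ℝ} (ht : 0 < t) :
    Quad ((0, 0) : ℝ × ℝ) (1, 0) (t, 1) (0, 1) t t 1 1 where
  ha := ht
  hb := ht
  hc := one_pos
  hd := one_pos
  hs := rfl
  hv := by ext <;> simp
  ind := by
    intro y z e
    simpa [Prod.ext_iff] using e

lemma std_mem {t : ℝ} (ht : 0 < t) (x y : ℝ) :
    (x, y) ∈ convexHull ℝ ({(0, 0), (1, 0), (t, 1), (0, 1)} : Set (ℝ × ℝ)) ↔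
      0 ≤ x ∧ 0 ≤ y ∧ y ≤ 1 ∧ x ≤ 1 + (t - 1) * y := by
  rw [(std_quad ht).mem_hull]
  constructor
  · rintro ⟨x', y', e, h1, h2, h3, h4⟩
    simp [Prod.ext_iff] at e
    obtain ⟨rfl, rfl⟩ := e
    refine ⟨h1, h2, ?_, by linarith⟩
    by_contra hn
    push Not at hn
    nlinarith
  · rintro ⟨h1, h2, h3, h4⟩
    refine ⟨x, y, by simp, h1, h2, by linarith, ?_⟩
    have := mul_nonneg ht.le (sub_nonneg.2 h3)
    linarith

lemma std_selfAffine {t : ℝ} (ht : 0 < t) :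
    IsSelfAffine 2 (convexHull ℝ ({(0, 0), (1, 0), (t, 1), (0, 1)} : Set (ℝ × ℝ))) := by
  have i1 : Indep2 ((1 / 2, 0) : ℝ × ℝ) (0, 1) := by
    intro y z e
    simpa [Prod.ext_iff] using e
  have i2 : Indep2 ((1 / 2, 0) : ℝ × ℝ) ((t - 1) / 2, 1) := by
    intro y z e
    simp [Prod.ext_iff] at e
    obtain ⟨e1, rfl⟩ := e
    simpa using e1
  obtain ⟨S, hS⟩ := exists_affT i1 (0, 0)
  obtain ⟨T, hT⟩ := exists_affT i2 (1 / 2, 0)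
  have hS' : ∀ x y : ℝ, S (x, y) = (x / 2, y) := fun x y => by
    rw [hS]; ext <;> simp <;> ring
  have hT' : ∀ x y : ℝ, T (x, y) = ((x + 1 + (t - 1) * y) / 2, y) := fun x y => by
    rw [hT]; ext <;> simp <;> ring
  set Q := convexHull ℝ ({(0, 0), (1, 0), (t, 1), (0, 1)} : Set (ℝ × ℝ)) with hQ
  have mS : ∀ x y : ℝ, (x, y) ∈ S '' Q ↔ 0 ≤ x ∧ 0 ≤ y ∧ y ≤ 1 ∧ 2 * x ≤ 1 + (t - 1) * y := by
    intro x y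
    constructor
    · rintro ⟨⟨x', y'⟩, hm, e⟩
      rw [std_mem ht] at hm
      rw [hS', Prod.mk.injEq] at e
      obtain ⟨rfl, rfl⟩ := e
      obtain ⟨h1, h2, h3, h4⟩ := hm
      exact ⟨by linarith, h2, h3, by linarith⟩
    · rintro ⟨h1, h2, h3, h4⟩
      refine ⟨(2 * x, y), (std_mem ht _ _).2 ⟨by linarith, h2, h3, h4⟩, ?_⟩
      rw [hS']; ext <;> simp
  have mT : ∀ x y : ℝ, (x, y) ∈ T '' Q ↔ 1 + (t - 1) * y ≤ 2 * x ∧ 0 ≤ y ∧ y ≤ 1 ∧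
      x ≤ 1 + (t - 1) * y := by
    intro x y
    constructor
    · rintro ⟨⟨x', y'⟩, hm, e⟩
      rw [std_mem ht] at hm
      rw [hT', Prod.mk.injEq] at e
      obtain ⟨rfl, rfl⟩ := e
      obtain ⟨h1, h2, h3, h4⟩ := hm
      exact ⟨by linarith, h2, h3, by linarith⟩
    · rintro ⟨h1, h2, h3, h4⟩
      refine ⟨(2 * x - 1 - (t - 1) * y, y), (std_mem ht _ _).2 ⟨by linarith, h2, h3, by linarith⟩, ?_⟩
      rw [hT', Prod.mk.injEq]; exact ⟨by ring, rfl⟩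
  have hdis : Disjoint (interior (S '' Q)) (interior (T '' Q)) := by
    rw [disjoint_iff_inter_eq_empty, ← interior_inter]
    by_contra hne
    obtain ⟨⟨x, y⟩, hp⟩ := nonempty_iff_ne_empty.2 hne
    have hnb := mem_interior_iff_mem_nhds.1 hp
    have hcont : ContinuousAt (fun s : ℝ => ((x + s, y) : ℝ × ℝ)) 0 := by fun_prop
    have hev : ∀ᶠ s in nhds (0 : ℝ), ((x + s, y) : ℝ × ℝ) ∈ S '' Q ∩ T '' Q :=
      hcont.preimage_mem_nhds (by simpa only [add_zero] using hnb)
    obtain ⟨ε, hε, hball⟩ := Metric.eventually_nhds_iff.1 hev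
    have k1 := hball (y := ε / 2) (by simp [abs_of_pos hε]; linarith)
    have k2 := hball (y := 0) (by simpa using hε)
    have l1 := (mS _ _).1 k1.1
    have l2 := (mT _ _).1 k2.2
    linarith [l1.2.2.2, l2.1]
  refine ⟨![S, T], ?_, ?_⟩
  · ext ⟨x, y⟩
    simp only [mem_iUnion, Fin.exists_fin_two, Matrix.cons_val_zero, Matrix.cons_val_one]
    rw [mS, mT, std_mem ht]
    constructor
    · rintro (⟨h1, h2, h3, h4⟩ | ⟨h1, h2, h3, h4⟩)
      · exact ⟨h1, h2, h3, by linarith⟩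
      · have : 0 ≤ 1 + (t - 1) * y := by nlinarith [mul_nonneg ht.le h2]
        exact ⟨by linarith, h2, h3, h4⟩
    · rintro ⟨h1, h2, h3, h4⟩
      rcases le_total (2 * x) (1 + (t - 1) * y) with h | h
      · exact Or.inl ⟨h1, h2, h3, h⟩
      · exact Or.inr ⟨h, h2, h3, h4⟩
  · intro i j hij
    fin_cases i <;> fin_cases j
    · exact absurd rfl hij
    · exact hdis
    · exact hdis.symm
    · exact absurd rfl hij

lemma backward_aux {a b c d : ℝ × ℝ} (h : NH a b c d)
    (hd : (segment ℝ a c ∩ segment ℝ b d).Nonempty) {t : ℝ} (ht : c - d = t • (b - a)) :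
    IsSelfAffine 2 (convexHull ℝ ({a, b, c, d} : Set (ℝ × ℝ))) := by
  obtain ⟨X, ⟨m, n, hm, hn, hmn, rfl⟩, ⟨p, q, hp, hq, hpq, e⟩⟩ := hd
  have hc : c = d + t • (b - a) := by rw [← ht]; module
  obtain ⟨e1, e2⟩ := h.ind (p - n * t) (q - n) (by
    obtain rfl : m = 1 - n := by linarith
    obtain rfl : p = 1 - q := by linarith
    rw [hc] at e
    linear_combination (norm := module) e)
  have hn0 : 0 < n := by
    rcases hn.eq_or_lt with h0 | h0
    · exfalso
      have : q = 0 := by linarith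
      have : p = 0 := by rw [← h0] at e1; linarith
      linarith
    · exact h0
  have ht0 : 0 < t := by
    rcases lt_trichotomy t 0 with h0 | h0 | h0
    · nlinarith
    · exfalso
      apply h.2.2.1
      rw [hc, h0]
      exact subset_convexHull _ _ (by simp)
    · exact h0
  obtain ⟨T, hT⟩ := exists_affT h.ind a
  have := (std_selfAffine ht0).image T
  rw [image_hull4, hT, hT, hT, hT] at this
  convert this using 3
  · module
  · congr 1
    · module
    · congr 1
      · rw [hc]; module
      · congr 1; module

lemma backward {Q : Set (ℝ × ℝ)} (h : IsTrapezoid Q) : IsSelfAffine 2 Q := by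
  obtain ⟨a, b, c, d, rfl, hA, hB, hC, hD, hd, ht⟩ := h
  rcases ht with ⟨t, ht⟩ | ⟨t, ht⟩
  · exact backward_aux ⟨hA, hB, hC, hD⟩ hd ht
  · rw [hull_rot]
    refine backward_aux (t := -t) ⟨?_, ?_, ?_, hA⟩ ?_ ?_
    · rwa [pair_comm d a, insert_comm c a]
    · rwa [pair_comm d a, insert_comm b a]
    · rwa [pair_comm c a, insert_comm b a]
    · rw [inter_comm, segment_symm ℝ c a]; exact hd
    · linear_combination (norm := module) (-1 : ℝ) • ht

/-- A convex quadrangle is `2`-self-affine if and only if it is a trapezoid. -/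
theorem convexQuadrangle_two_self_affine_iff_trapezoid (Q : Set (ℝ × ℝ))
    (hQ : IsConvexQuadrangle Q) : IsSelfAffine 2 Q ↔ IsTrapezoid Q := by
  exact ⟨forward hQ, backward⟩
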